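/- Let A be a finite subset of ℤ that does not contain any five consecutive integers. Then there are only finitely many isomorphism classes of indecomposable e(2)-modules V with the property that V_k = 0 whenever k ∉ A; that is, there exists a finite list V¹, …, Vⁿ of e(2)-modules such that every indecomposable e(2)-module V with V_k = 0 for all k ∉ A is isomorphic to some Vʲ. -/

import Mathlib

/-- An `e(2)`-module: a finite-dimensional complex vector space `V` with endomorphisms
`Pp = P₊`, `Pm = P₋`, `L` satisfying `P₊∘P₋ = P₋∘P₊`, `L∘P₊ − P₊∘L = P₊`,
`L∘P₋ − P₋∘L = −P₋`, such that `V` is the internal direct sum of the eigenspaces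
`V_k = ker (L − k·id)`, `k ∈ ℤ`. -/
structure E2Mod : Type 1 where
  V : Type
  [acg : AddCommGroup V]
  [mod : Module ℂ V]
  [fd : FiniteDimensional ℂ V]
  Pp : V →ₗ[ℂ] V
  Pm : V →ₗ[ℂ] V
  L : V →ₗ[ℂ] V
  comm : Pp.comp Pm = Pm.comp Pp
  relp : L.comp Pp - Pp.comp L = Pp
  relm : L.comp Pm - Pm.comp L = -Pm
  internal : DirectSum.IsInternal fun k : ℤ =>
    LinearMap.ker (L - (k : ℂ) • (LinearMap.id : V →ₗ[ℂ] V))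

attribute [instance] E2Mod.acg E2Mod.mod E2Mod.fd

namespace E2Mod

/-- The `k`-weight space `V_k = ker (L - k·id)`. -/
def wt (M : E2Mod) (k : ℤ) : Submodule ℂ M.V :=
  LinearMap.ker (M.L - (k : ℂ) • (LinearMap.id : M.V →ₗ[ℂ] M.V))

/-- A subspace is a submodule if it is invariant under `P₊`, `P₋` and `L`. -/
def IsSubmod (M : E2Mod) (S : Submodule ℂ M.V) : Prop :=
  (∀ v ∈ S, M.Pp v ∈ S) ∧ (∀ v ∈ S, M.Pm v ∈ S) ∧ (∀ v ∈ S, M.L v ∈ S)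

/-- An `e(2)`-module is indecomposable if it is nonzero and admits no nontrivial
decomposition as an internal direct sum of two submodules. -/
def Indecomposable (M : E2Mod) : Prop :=
  (∃ v : M.V, v ≠ 0) ∧
    ∀ W₁ W₂ : Submodule ℂ M.V, M.IsSubmod W₁ → M.IsSubmod W₂ →
      W₁ ⊓ W₂ = ⊥ → W₁ ⊔ W₂ = ⊤ → W₁ = ⊥ ∨ W₂ = ⊥

/-- Isomorphism of `e(2)`-modules: a bijective linear map commuting with `P₊, P₋, L`. -/
def Iso (M N : E2Mod) : Prop :=
  ∃ e : M.V ≃ₗ[ℂ] N.V,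
    (∀ v, e (M.Pp v) = N.Pp (e v)) ∧ (∀ v, e (M.Pm v) = N.Pm (e v)) ∧
      (∀ v, e (M.L v) = N.L (e v))

end E2Mod


/-! ### Linear algebra over a field -/

section LinearAlgebra

variable {X Y Z : Type} [AddCommGroup X] [Module ℂ X] [AddCommGroup Y] [Module ℂ Y]
  [AddCommGroup Z] [Module ℂ Z]

/-- A linear map that vanishes on `ker g` factors through `g`. -/
lemma exists_comp_eq_of_ker_le (g : X →ₗ[ℂ] Y) (h : X →ₗ[ℂ] Z)
    (hk : ∀ x, g x = 0 → h x = 0) : ∃ t : Y →ₗ[ℂ] Z, ∀ x, t (g x) = h x := by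
  obtain ⟨s, hs⟩ := g.rangeRestrict.exists_rightInverse_of_surjective
    (LinearMap.range_rangeRestrict g)
  obtain ⟨t, ht⟩ := LinearMap.exists_extend (h.comp s)
  refine ⟨t, fun x => ?_⟩
  have h1 : t (g x) = h (s (g.rangeRestrict x)) := LinearMap.congr_fun ht (g.rangeRestrict x)
  have h2 : g (s (g.rangeRestrict x)) = g x :=
    congrArg Subtype.val (LinearMap.congr_fun hs (g.rangeRestrict x))
  rw [h1, ← sub_eq_zero, ← map_sub]
  exact hk _ (by rw [map_sub, h2, sub_self])

/-- A linear map whose values lie in `range g` lifts along `g`. -/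
lemma exists_comp_eq_of_mem_range (g : X →ₗ[ℂ] Y) (h : Z →ₗ[ℂ] Y)
    (hr : ∀ z, h z ∈ LinearMap.range g) : ∃ t : Z →ₗ[ℂ] X, ∀ z, g (t z) = h z := by
  obtain ⟨s, hs⟩ := g.rangeRestrict.exists_rightInverse_of_surjective
    (LinearMap.range_rangeRestrict g)
  exact ⟨s.comp (h.codRestrict _ hr), fun z =>
    congrArg Subtype.val (LinearMap.congr_fun hs (h.codRestrict _ hr z))⟩

lemma exists_functional_eq_one (S : Submodule ℂ X) (x : X) (hx : x ∉ S) :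
    ∃ t : X →ₗ[ℂ] ℂ, t x = 1 ∧ ∀ y ∈ S, t y = 0 := by
  obtain ⟨t, ht, hS⟩ := Submodule.exists_le_ker_of_notMem hx
  exact ⟨(t x)⁻¹ • t, by simp [ht], fun y hy => by
    simp [LinearMap.mem_ker.mp (hS hy)]⟩

variable {X' Y' : Type} [AddCommGroup X'] [Module ℂ X'] [AddCommGroup Y'] [Module ℂ Y']

/-- If `f` is compatible with the endomorphisms `c ∘ d`, the subspaces `range c` and the subspaces
`ker d`, then it extends to the spaces through which `c ∘ d` is factored. -/
lemma exists_extension_of_factorization (d : X →ₗ[ℂ] Y) (c : Y →ₗ[ℂ] X) (d' : X' →ₗ[ℂ] Y')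
    (c' : Y' →ₗ[ℂ] X') (f : X →ₗ[ℂ] X') (hcd : ∀ x, f (c (d x)) = c' (d' (f x)))
    (hd : ∀ x, d x = 0 → d' (f x) = 0) (hc : ∀ y, f (c y) ∈ LinearMap.range c') :
    ∃ e : Y →ₗ[ℂ] Y', (∀ x, e (d x) = d' (f x)) ∧ ∀ y, c' (e y) = f (c y) := by
  obtain ⟨k, hk⟩ := exists_comp_eq_of_ker_le d (d'.comp f) hd
  obtain ⟨h, hh⟩ := exists_comp_eq_of_mem_range c' (f.comp c) hc
  simp only [LinearMap.comp_apply] at hk hh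
  obtain ⟨q, hq⟩ := LinearMap.exists_extend (LinearMap.id (R := ℂ) (M := LinearMap.range d))
  have hqd : ∀ x, (q (d x) : Y) = d x := fun x =>
    congrArg Subtype.val (LinearMap.congr_fun hq ⟨d x, x, rfl⟩)
  refine ⟨h + (k - h).comp ((LinearMap.range d).subtype.comp q), fun x => ?_, fun y => ?_⟩
  · simp [hqd, hk]
  · obtain ⟨x, hx⟩ := (q y).2
    simp [← hx, hk, hh, hcd]

end LinearAlgebra

/-! ### Pairs of flagged spaces -/

/-- Two spaces with maps `a`, `b` in opposite directions, each with a two-step flag lying between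
the image and the kernel of the endomorphism induced by `a` and `b`. -/
structure FlagPair (V W : Type) [AddCommGroup V] [Module ℂ V] [AddCommGroup W]
    [Module ℂ W] where
  a : V →ₗ[ℂ] W
  b : W →ₗ[ℂ] V
  F : ℕ → Submodule ℂ V
  G : ℕ → Submodule ℂ W
  F_mono : Monotone F
  G_mono : Monotone G
  F_zero : F 0 = ⊥
  G_zero : G 0 = ⊥
  F_three : F 3 = ⊤
  G_three : G 3 = ⊤
  ba_mem : ∀ x, b (a x) ∈ F 1
  ab_mem : ∀ y, a (b y) ∈ G 1
  ba_eq : ∀ x ∈ F 2, b (a x) = 0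
  ab_eq : ∀ y ∈ G 2, a (b y) = 0

namespace FlagPair

variable {V W V' W' : Type} [AddCommGroup V] [Module ℂ V] [AddCommGroup W] [Module ℂ W]
  [AddCommGroup V'] [Module ℂ V'] [AddCommGroup W'] [Module ℂ W']

/-- Exchange the roles of the two spaces. -/
def swap (D : FlagPair V W) : FlagPair W V where
  a := D.b
  b := D.a
  F := D.G
  G := D.F
  F_mono := D.G_mono
  G_mono := D.F_mono
  F_zero := D.G_zero
  G_zero := D.F_zero
  F_three := D.G_three
  G_three := D.F_three
  ba_mem := D.ab_mem
  ab_mem := D.ba_mem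
  ba_eq := D.ab_eq
  ab_eq := D.ba_eq

/-- Morphisms of flag pairs. -/
structure IsHom (D : FlagPair V W) (D' : FlagPair V' W') (f : V →ₗ[ℂ] V')
    (g : W →ₗ[ℂ] W') : Prop where
  map_a : ∀ x, g (D.a x) = D'.a (f x)
  map_b : ∀ y, f (D.b y) = D'.b (g y)
  map_F : ∀ s, ∀ x ∈ D.F s, f x ∈ D'.F s
  map_G : ∀ s, ∀ y ∈ D.G s, g y ∈ D'.G s

lemma IsHom.swap {D : FlagPair V W} {D' : FlagPair V' W'} {f : V →ₗ[ℂ] V'} {g : W →ₗ[ℂ] W'}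
    (h : D.IsHom D' f g) : D.swap.IsHom D'.swap g f :=
  ⟨h.map_b, h.map_a, h.map_G, h.map_F⟩

/-- There are morphisms in both directions whose composition fixes a nonzero vector. -/
def Linked (D : FlagPair V W) (D' : FlagPair V' W') : Prop :=
  ∃ f g f' g', D.IsHom D' f g ∧ D'.IsHom D f' g' ∧
    ((∃ x ≠ 0, f' (f x) = x) ∨ ∃ y ≠ 0, g' (g y) = y)

lemma Linked.of_swap {D : FlagPair V W} {D' : FlagPair V' W'} (h : D.swap.Linked D'.swap) :
    D.Linked D' := by
  obtain ⟨f, g, f', g', h1, h2, h3⟩ := h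
  exact ⟨g, f, g', f', h1.swap, h2.swap, h3.symm⟩

lemma linked_of_apply {D : FlagPair V W} {D' : FlagPair V' W'} {v : V} {v' : V'} (hv : v ≠ 0)
    (h : ∃ f g, D.IsHom D' f g ∧ f v = v') (h' : ∃ f g, D'.IsHom D f g ∧ f v' = v) :
    D.Linked D' := by
  obtain ⟨f, g, h1, h2⟩ := h
  obtain ⟨f', g', h1', h2'⟩ := h'
  exact ⟨f, g, f', g', h1, h1', Or.inl ⟨v, hv, by rw [h2, h2']⟩⟩

lemma mem_F_of_three_le (D : FlagPair V W) {s : ℕ} (hs : 3 ≤ s) (x : V) : x ∈ D.F s :=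
  D.F_mono hs (by rw [D.F_three]; trivial)

lemma mem_G_of_three_le (D : FlagPair V W) {s : ℕ} (hs : 3 ≤ s) (x : W) : x ∈ D.G s :=
  D.swap.mem_F_of_three_le hs x

/-- To respect a flag it suffices to send the second step to the first one. -/
lemma map_F_of_forall (D : FlagPair V W) (D' : FlagPair V' W') (f : V →ₗ[ℂ] V')
    (h : ∀ x ∈ D.F 2, f x ∈ D'.F 1) (s : ℕ) (x : V) (hx : x ∈ D.F s) : f x ∈ D'.F s := by
  rcases Nat.eq_zero_or_pos s with rfl | h0
  · rw [D.F_zero, Submodule.mem_bot] at hx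
    simp [hx]
  · rcases Nat.lt_or_ge s 3 with h3 | h3
    · exact D'.F_mono h0 (h x (D.F_mono (by omega) hx))
    · exact D'.mem_F_of_three_le h3 _

lemma map_G_of_forall (D : FlagPair V W) (D' : FlagPair V' W') (g : W →ₗ[ℂ] W')
    (h : ∀ y ∈ D.G 2, g y ∈ D'.G 1) (s : ℕ) (y : W) (hy : y ∈ D.G s) : g y ∈ D'.G s :=
  map_F_of_forall D.swap D'.swap g h s y hy

/-- Witness for a summand on which `a ∘ b ∘ a` does not vanish. -/
def ProjData (D : FlagPair V W) (v : V) (θ : W →ₗ[ℂ] ℂ) : Prop :=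
  θ (D.a (D.b (D.a v))) = 1

/-- Witness for a summand with basis `v`, `a v`, in positions `p`, `q` of the flags. -/
structure ChainData (D : FlagPair V W) (p q : ℕ) (v : V) (θ : W →ₗ[ℂ] ℂ) : Prop where
  mem_F : v ∈ D.F p
  mem_G : D.a v ∈ D.G q
  ba : D.b (D.a v) = 0
  val : θ (D.a v) = 1
  θab : ∀ y, θ (D.a (D.b y)) = 0
  θF : ∀ s < p, ∀ x ∈ D.F s, θ (D.a x) = 0
  θG : ∀ s < q, ∀ y ∈ D.G s, θ y = 0

/-- Witness for a one-dimensional summand in position `p`. -/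
structure SimpleData (D : FlagPair V W) (p : ℕ) (v : V) (ψ : V →ₗ[ℂ] ℂ) : Prop where
  mem_F : v ∈ D.F p
  av : D.a v = 0
  val : ψ v = 1
  ψb : ∀ y, ψ (D.b y) = 0
  ψF : ∀ s < p, ∀ x ∈ D.F s, ψ x = 0

/-- Witness for a summand with basis `w`, `b w`, `a (b w)`, where `b w` is in position `p`. -/
structure MiddleData (D : FlagPair V W) (p : ℕ) (w : W) (θ : W →ₗ[ℂ] ℂ) : Prop where
  mem_F : D.b w ∈ D.F p
  bab : D.b (D.a (D.b w)) = 0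
  val : θ (D.a (D.b w)) = 1
  θaba : ∀ x, θ (D.a (D.b (D.a x))) = 0
  θF : ∀ s < p, ∀ x ∈ D.F s, θ (D.a x) = 0

/-- Witness for a summand with basis `v`, `b w`, `w`, `a (b w)`, where `v + b w` is in
position `p` and the plane spanned by `v` and `b w` is in position `r`. -/
structure DiagonalData (D : FlagPair V W) (p r : ℕ) (v : V) (w : W) (α : V →ₗ[ℂ] ℂ)
    (θ : W →ₗ[ℂ] ℂ) : Prop where
  le : p ≤ r
  mem_F : v + D.b w ∈ D.F p
  mem_F' : v ∈ D.F r
  av : D.a v = 0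
  bab : D.b (D.a (D.b w)) = 0
  α_val : α v = 1
  αb : ∀ y, α (D.b y) = 0
  θaba : ∀ x, θ (D.a (D.b (D.a x))) = 0
  αF : ∀ s < p, ∀ x ∈ D.F s, α x = 0
  αθ : ∀ s < r, ∀ x ∈ D.F s, α x = θ (D.a x)

lemma ProjData.exists_hom {D : FlagPair V W} {v : V} {θ : W →ₗ[ℂ] ℂ} (h : D.ProjData v θ)
    (D' : FlagPair V' W') (v' : V') :
    ∃ f g, D.IsHom D' f g ∧ f (D.b (D.a v)) = D'.b (D'.a v') := by
  have hz : ∀ x, D.b (D.a (D.b (D.a x))) = 0 := fun x =>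
    D.ba_eq _ (D.F_mono one_le_two (D.ba_mem x))
  have hz' : ∀ x, D'.b (D'.a (D'.b (D'.a x))) = 0 := fun x =>
    D'.ba_eq _ (D'.F_mono one_le_two (D'.ba_mem x))
  have hw : ∀ y, D.a (D.b (D.a (D.b y))) = 0 := fun x =>
    D.ab_eq _ (D.G_mono one_le_two (D.ab_mem x))
  have h0 : θ (D.a (D.b (D.a v))) = 1 := h
  refine ⟨(θ.comp (D.a.comp (D.b.comp D.a))).smulRight v' +
      (θ.comp D.a).smulRight (D'.b (D'.a v')),
    (θ.comp (D.a.comp D.b)).smulRight (D'.a v') + θ.smulRight (D'.a (D'.b (D'.a v'))),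
    ⟨fun x => by simp, fun y => by simp [hw, hz'], ?_, ?_⟩, by simp [hz, h0]⟩
  · exact map_F_of_forall D D' _ fun x hx => by
      simpa [D.ba_eq x hx] using Submodule.smul_mem _ _ (D'.ba_mem _)
  · exact map_G_of_forall D D' _ fun y hy => by
      simpa [D.ab_eq y hy] using Submodule.smul_mem _ _ (D'.ab_mem _)

lemma ProjData.linked {D : FlagPair V W} {D' : FlagPair V' W'} {v : V} {θ : W →ₗ[ℂ] ℂ}
    {v' : V'} {θ' : W' →ₗ[ℂ] ℂ} (h : D.ProjData v θ) (h' : D'.ProjData v' θ') :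
    D.Linked D' := by
  refine linked_of_apply (fun h0 => ?_) (h.exists_hom D' v') (h'.exists_hom D v)
  have h1 : θ (D.a (D.b (D.a v))) = 1 := h
  simp [h0] at h1

lemma ChainData.exists_hom {D : FlagPair V W} {D' : FlagPair V' W'} {p q : ℕ} {v : V}
    {θ : W →ₗ[ℂ] ℂ} {v' : V'} {θ' : W' →ₗ[ℂ] ℂ} (h : D.ChainData p q v θ)
    (h' : D'.ChainData p q v' θ') : ∃ f g, D.IsHom D' f g ∧ f v = v' := by
  refine ⟨(θ.comp D.a).smulRight v', θ.smulRight (D'.a v'),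
    ⟨fun x => by simp, fun y => by simp [h.θab, h'.ba], fun s x hx => ?_, fun s y hy => ?_⟩,
    by simp [h.val]⟩
  · rcases Nat.lt_or_ge s p with hs | hs
    · simp [h.θF s hs x hx]
    · exact Submodule.smul_mem _ _ (D'.F_mono hs h'.mem_F)
  · rcases Nat.lt_or_ge s q with hs | hs
    · simp [h.θG s hs y hy]
    · exact Submodule.smul_mem _ _ (D'.G_mono hs h'.mem_G)

lemma ChainData.linked {D : FlagPair V W} {D' : FlagPair V' W'} {p q : ℕ} {v : V}
    {θ : W →ₗ[ℂ] ℂ} {v' : V'} {θ' : W' →ₗ[ℂ] ℂ} (h : D.ChainData p q v θ)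
    (h' : D'.ChainData p q v' θ') : D.Linked D' := by
  refine linked_of_apply (fun h0 => ?_) (h.exists_hom h') (h'.exists_hom h)
  have h1 := h.val
  simp [h0] at h1

lemma SimpleData.exists_hom {D : FlagPair V W} {D' : FlagPair V' W'} {p : ℕ} {v : V}
    {ψ : V →ₗ[ℂ] ℂ} {v' : V'} {ψ' : V' →ₗ[ℂ] ℂ} (h : D.SimpleData p v ψ)
    (h' : D'.SimpleData p v' ψ') : ∃ f g, D.IsHom D' f g ∧ f v = v' := by
  refine ⟨ψ.smulRight v', 0,
    ⟨fun x => by simp [h'.av], fun y => by simp [h.ψb], fun s x hx => ?_, fun s y hy => by simp⟩,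
    by simp [h.val]⟩
  rcases Nat.lt_or_ge s p with hs | hs
  · simp [h.ψF s hs x hx]
  · exact Submodule.smul_mem _ _ (D'.F_mono hs h'.mem_F)

lemma SimpleData.linked {D : FlagPair V W} {D' : FlagPair V' W'} {p : ℕ} {v : V}
    {ψ : V →ₗ[ℂ] ℂ} {v' : V'} {ψ' : V' →ₗ[ℂ] ℂ} (h : D.SimpleData p v ψ)
    (h' : D'.SimpleData p v' ψ') : D.Linked D' := by
  refine linked_of_apply (fun h0 => ?_) (h.exists_hom h') (h'.exists_hom h)
  have h1 := h.val
  simp [h0] at h1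

lemma MiddleData.exists_hom {D : FlagPair V W} {D' : FlagPair V' W'} {p : ℕ} {w : W}
    {θ : W →ₗ[ℂ] ℂ} {w' : W'} {θ' : W' →ₗ[ℂ] ℂ} (h : D.MiddleData p w θ)
    (h' : D'.MiddleData p w' θ') : ∃ f g, D.IsHom D' f g ∧ f (D.b w) = D'.b w' := by
  refine ⟨(θ.comp D.a).smulRight (D'.b w'),
    (θ.comp (D.a.comp D.b)).smulRight w' + θ.smulRight (D'.a (D'.b w')),
    ⟨fun x => by simp [h.θaba], fun y => by simp [h'.bab], fun s x hx => ?_, ?_⟩,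
    by simp [h.val]⟩
  · rcases Nat.lt_or_ge s p with hs | hs
    · simp [h.θF s hs x hx]
    · exact Submodule.smul_mem _ _ (D'.F_mono hs h'.mem_F)
  · exact map_G_of_forall D D' _ fun y hy => by
      simpa [D.ab_eq y hy] using Submodule.smul_mem _ _ (D'.ab_mem _)

lemma MiddleData.linked {D : FlagPair V W} {D' : FlagPair V' W'} {p : ℕ} {w : W}
    {θ : W →ₗ[ℂ] ℂ} {w' : W'} {θ' : W' →ₗ[ℂ] ℂ} (h : D.MiddleData p w θ)
    (h' : D'.MiddleData p w' θ') : D.Linked D' := by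
  refine linked_of_apply (fun h0 => ?_) (h.exists_hom h') (h'.exists_hom h)
  have h1 := h.val
  simp [h0] at h1

lemma DiagonalData.exists_hom {D : FlagPair V W} {D' : FlagPair V' W'} {p r : ℕ} {v : V} {w : W}
    {α : V →ₗ[ℂ] ℂ} {θ : W →ₗ[ℂ] ℂ} {v' : V'} {w' : W'} {α' : V' →ₗ[ℂ] ℂ} {θ' : W' →ₗ[ℂ] ℂ}
    (h : D.DiagonalData p r v w α θ) (h' : D'.DiagonalData p r v' w' α' θ') :
    ∃ f g, D.IsHom D' f g ∧ f v = v' := by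
  refine ⟨α.smulRight v' + (θ.comp D.a).smulRight (D'.b w'),
    (θ.comp (D.a.comp D.b)).smulRight w' + θ.smulRight (D'.a (D'.b w')),
    ⟨fun x => by simp [h.θaba, h'.av], fun y => by simp [h'.bab, h.αb], fun s x hx => ?_, ?_⟩,
    by simp [h.α_val, h.av]⟩
  · rcases Nat.lt_or_ge s r with hs | hs
    · have h1 := h.αθ s hs x hx
      rcases Nat.lt_or_ge s p with hp | hp
      · simp [← h1, h.αF s hp x hx]
      · have h2 := Submodule.smul_mem _ (α x) (D'.F_mono hp h'.mem_F)
        simpa [← h1] using h2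
    · have h1 := D'.F_mono hs h'.mem_F'
      have h2 := Submodule.sub_mem _ (D'.F_mono (h.le.trans hs) h'.mem_F) h1
      rw [add_sub_cancel_left] at h2
      exact Submodule.add_mem _ (Submodule.smul_mem _ _ h1) (Submodule.smul_mem _ _ h2)
  · exact map_G_of_forall D D' _ fun y hy => by
      simpa [D.ab_eq y hy] using Submodule.smul_mem _ _ (D'.ab_mem _)

lemma DiagonalData.linked {D : FlagPair V W} {D' : FlagPair V' W'} {p r : ℕ} {v : V} {w : W}
    {α : V →ₗ[ℂ] ℂ} {θ : W →ₗ[ℂ] ℂ} {v' : V'} {w' : W'} {α' : V' →ₗ[ℂ] ℂ} {θ' : W' →ₗ[ℂ] ℂ}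
    (h : D.DiagonalData p r v w α θ) (h' : D'.DiagonalData p r v' w' α' θ') :
    D.Linked D' := by
  refine linked_of_apply (fun h0 => ?_) (h.exists_hom h') (h'.exists_hom h)
  have h1 := h.α_val
  simp [h0] at h1

/-- The discrete types of summands. -/
inductive Kind
  | proj
  | chain (p q : Fin 4)
  | simple (p : Fin 4)
  | middle (p : Fin 4)
  | diagonal (p r : Fin 4)

instance : Finite Kind := by
  let f : Kind → Fin 5 × Fin 4 × Fin 4
    | .proj => (0, 0, 0)
    | .chain p q => (1, p, q)
    | .simple p => (2, p, 0)
    | .middle p => (3, p, 0)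
    | .diagonal p r => (4, p, r)
  refine Finite.of_injective f fun x y h => ?_
  cases x <;> cases y <;> simp_all [f]

/-- `D` has a summand of the given kind. -/
def HasKind (D : FlagPair V W) : Kind → Prop
  | .proj => ∃ v θ, D.ProjData v θ
  | .chain p q => ∃ v θ, D.ChainData p q v θ
  | .simple p => ∃ v ψ, D.SimpleData p v ψ
  | .middle p => ∃ w θ, D.MiddleData p w θ
  | .diagonal p r => ∃ v w α θ, D.DiagonalData p r v w α θ

lemma HasKind.linked {D : FlagPair V W} {D' : FlagPair V' W'} :
    ∀ {c : Kind}, D.HasKind c → D'.HasKind c → D.Linked D'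
  | .proj, ⟨_, _, h⟩, ⟨_, _, h'⟩ => h.linked h'
  | .chain _ _, ⟨_, _, h⟩, ⟨_, _, h'⟩ => h.linked h'
  | .simple _, ⟨_, _, h⟩, ⟨_, _, h'⟩ => h.linked h'
  | .middle _, ⟨_, _, h⟩, ⟨_, _, h'⟩ => h.linked h'
  | .diagonal _ _, ⟨_, _, _, _, h⟩, ⟨_, _, _, _, h'⟩ => h.linked h'

lemma hasKind_proj (D : FlagPair V W) (v : V) (hv : D.a (D.b (D.a v)) ≠ 0) :
    D.HasKind .proj := by
  obtain ⟨θ, h, -⟩ := exists_functional_eq_one ⊥ _ (by simpa using hv)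
  exact ⟨v, θ, h⟩

lemma hasKind_chain (D : FlagPair V W) (v : V) (hv : D.b (D.a v) = 0)
    (hn : v ∉ LinearMap.ker D.a ⊔ LinearMap.range D.b) :
    ∃ c, D.HasKind c := by
  classical
  set N := LinearMap.ker D.a ⊔ LinearMap.range D.b
  have hp : ∃ p, ∃ v ∈ D.F p, D.b (D.a v) = 0 ∧ v ∉ N :=
    ⟨3, v, D.mem_F_of_three_le le_rfl v, hv, hn⟩
  set p := Nat.find hp with hpdef
  have hp3 : p ≤ 3 := Nat.find_min' hp ⟨v, D.mem_F_of_three_le le_rfl v, hv, hn⟩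
  obtain ⟨v₁, hv₁F, hv₁, hv₁n⟩ := Nat.find_spec hp
  have hq : ∃ q, ∃ v ∈ D.F p, D.a v ∈ D.G q ∧ D.b (D.a v) = 0 ∧ v ∉ N :=
    ⟨3, v₁, hv₁F, D.mem_G_of_three_le le_rfl _, hv₁, hv₁n⟩
  set q := Nat.find hq with hqdef
  have hq3 : q ≤ 3 :=
    Nat.find_min' hq ⟨v₁, hv₁F, D.mem_G_of_three_le le_rfl _, hv₁, hv₁n⟩
  obtain ⟨u, huF, huG, hu, hun⟩ := Nat.find_spec hq
  rw [← hqdef] at huG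
  have hp0 : p ≠ 0 := fun h0 => hun <| by
    rw [h0, D.F_zero, Submodule.mem_bot] at huF
    simp [huF]
  have hq0 : q ≠ 0 := fun h0 => hun <| by
    rw [h0, D.G_zero, Submodule.mem_bot] at huG
    exact Submodule.mem_sup_left huG
  have hnot : D.a u ∉ LinearMap.range (D.a.comp D.b) ⊔ (D.F (p - 1)).map D.a ⊔ D.G (q - 1) := by
    intro hmem
    obtain ⟨y, hy, g, hg, hyg⟩ := Submodule.mem_sup.mp hmem
    obtain ⟨y₁, ⟨w, rfl⟩, y₂, ⟨x, hx, rfl⟩, rfl⟩ := Submodule.mem_sup.mp hy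
    have hxN : x ∈ N := by
      by_contra hxN
      refine Nat.find_min hp (m := p - 1) (by omega) ⟨x, hx, ?_, hxN⟩
      exact D.ba_eq x (D.F_mono (by omega) hx)
    obtain ⟨k, hk, _, ⟨w', rfl⟩, rfl⟩ := Submodule.mem_sup.mp hxN
    have hk0 : D.a k = 0 := hk
    have e : D.a (D.b (w + w')) + g = D.a u := by
      rw [← hyg]; simp [hk0]
    have hG : D.a u ∈ D.G (q - 1) ∨ q = 1 := by
      rcases Nat.lt_or_ge 1 q with h1 | h1
      · left
        rw [← e]
        exact Submodule.add_mem _ (D.G_mono (by omega) (D.ab_mem _)) hg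
      · right; omega
    rcases hG with hG | h1
    · exact Nat.find_min hq (m := q - 1) (by omega) ⟨u, huF, hG, hu, hun⟩
    · have hg0 : g = 0 := by
        simpa [h1, D.G_zero] using hg
      refine hun (Submodule.mem_sup.mpr ⟨u - D.b (w + w'), ?_, D.b (w + w'), ⟨_, rfl⟩, by simp⟩)
      rw [LinearMap.mem_ker, map_sub, ← e, hg0]
      simp
  obtain ⟨θ, hθ, hθ0⟩ := exists_functional_eq_one _ _ hnot
  refine ⟨.chain ⟨p, by omega⟩ ⟨q, by omega⟩, u, θ, huF, huG, hu, hθ, fun y => ?_,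
    fun s hs x hx => ?_, fun s hs y hy => ?_⟩
  · exact hθ0 _ (Submodule.mem_sup_left (Submodule.mem_sup_left ⟨y, rfl⟩))
  · have hs' : s < p := hs
    exact hθ0 _ (Submodule.mem_sup_left (Submodule.mem_sup_right
      ⟨x, D.F_mono (by omega) hx, rfl⟩))
  · have hs' : s < q := hs
    exact hθ0 _ (Submodule.mem_sup_right (D.G_mono (by omega) hy))

lemma hasKind_simple_or_diagonal (D : FlagPair V W)
    (haba : ∀ x, D.a (D.b (D.a x)) = 0) (hbab : ∀ y, D.b (D.a (D.b y)) = 0)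
    (hB : ∀ y, D.a (D.b y) = 0 → y ∈ LinearMap.ker D.b ⊔ LinearMap.range D.a)
    (v : V) (hv : D.a v = 0) (hn : v ∉ LinearMap.range (D.b.comp D.a)) :
    ∃ c, D.HasKind c := by
  classical
  set N := LinearMap.range (D.b.comp D.a)
  have hr : ∃ r, ∃ v ∈ D.F r, D.a v = 0 ∧ v ∉ N :=
    ⟨3, v, D.mem_F_of_three_le le_rfl v, hv, hn⟩
  set r := Nat.find hr with hrdef
  have hr3 : r ≤ 3 := Nat.find_min' hr ⟨v, D.mem_F_of_three_le le_rfl v, hv, hn⟩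
  obtain ⟨u, huF, hu, hun⟩ := Nat.find_spec hr
  rw [← hrdef] at huF
  have hp : ∃ p, u ∈ D.F p ⊔ LinearMap.range D.b := ⟨r, Submodule.mem_sup_left huF⟩
  set p := Nat.find hp with hpdef
  have hpr : p ≤ r := Nat.find_min' hp (Submodule.mem_sup_left huF)
  have hup : u ∈ D.F p ⊔ LinearMap.range D.b := Nat.find_spec hp
  have hp0 : p ≠ 0 := fun h0 => hun <| by
    rw [h0, D.F_zero, bot_sup_eq] at hup
    obtain ⟨w, rfl⟩ := hup
    obtain ⟨k, hk, _, ⟨x, rfl⟩, rfl⟩ := Submodule.mem_sup.mp (hB w hu)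
    refine ⟨x, ?_⟩
    rw [LinearMap.mem_ker] at hk
    simp [hk]
  obtain ⟨α, hα, hα0⟩ := exists_functional_eq_one _ _ (Nat.find_min hp (m := p - 1) (by omega))
  have hαb : ∀ y, α (D.b y) = 0 := fun y => hα0 _ (Submodule.mem_sup_right ⟨y, rfl⟩)
  have hαF : ∀ s < p, ∀ x ∈ D.F s, α x = 0 := fun s hs x hx =>
    hα0 _ (Submodule.mem_sup_left (D.F_mono (by omega) hx))
  rcases hpr.lt_or_eq with hlt | heq
  · obtain ⟨f, hf, _, ⟨w, rfl⟩, hfw⟩ := Submodule.mem_sup.mp hup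
    obtain ⟨θ, hθ⟩ := exists_comp_eq_of_ker_le (D.a.comp (D.F (r - 1)).subtype)
      (α.comp (D.F (r - 1)).subtype) fun x hx => by
        have hxN : (x : V) ∈ N := by
          by_contra hxN
          exact Nat.find_min hr (m := r - 1) (by omega) ⟨x, x.2, hx, hxN⟩
        obtain ⟨y, hy⟩ := hxN
        simp only [LinearMap.comp_apply, Submodule.subtype_apply] at hy ⊢
        rw [← hy, hαb]
    refine ⟨.diagonal ⟨p, by omega⟩ ⟨r, by omega⟩, u, -w, α, θ, hpr, ?_, huF, hu, hbab _, hα,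
      hαb, fun x => by simp [haba], hαF, fun s hs x hx => ?_⟩
    · have e : u + D.b (-w) = f := by rw [← hfw, map_neg, add_neg_cancel_right]
      exact e ▸ hf
    · have hs' : s < r := hs
      exact (hθ ⟨x, D.F_mono (by omega) hx⟩).symm
  · exact ⟨.simple ⟨p, by omega⟩, u, α, D.F_mono heq.ge huF, hu, hα, hαb, hαF⟩

lemma hasKind_middle (D : FlagPair V W)
    (haba : ∀ x, D.a (D.b (D.a x)) = 0) (hbab : ∀ y, D.b (D.a (D.b y)) = 0)
    (hX : ∀ x, D.a x = 0 → x ∈ LinearMap.range (D.b.comp D.a))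
    (w : W) (hn : D.b w ∉ LinearMap.range (D.b.comp D.a)) :
    ∃ c, D.HasKind c := by
  classical
  set N := LinearMap.range (D.b.comp D.a)
  have hr : ∃ r, ∃ w, D.b w ∈ D.F r ∧ D.b w ∉ N :=
    ⟨3, w, D.mem_F_of_three_le le_rfl _, hn⟩
  set r := Nat.find hr with hrdef
  have hr3 : r ≤ 3 := Nat.find_min' hr ⟨w, D.mem_F_of_three_le le_rfl _, hn⟩
  obtain ⟨u, huF, hun⟩ := Nat.find_spec hr
  rw [← hrdef] at huF
  have hr0 : r ≠ 0 := fun h0 => hun <| by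
    rw [h0, D.F_zero, Submodule.mem_bot] at huF
    simp [huF]
  have hnot : D.a (D.b u) ∉ (D.F (r - 1)).map D.a := by
    rintro ⟨x, hx, hxu⟩
    obtain ⟨t, ht⟩ := hX (D.b u - x) (by rw [map_sub, hxu, sub_self])
    have hx' : x = D.b (u - D.a t) := by
      rw [map_sub, eq_sub_iff_add_eq, ← LinearMap.comp_apply, ht]
      abel
    have hxN : x ∈ N := by
      by_contra hxN
      rw [hx'] at hx hxN
      exact Nat.find_min hr (m := r - 1) (by omega) ⟨_, hx, hxN⟩
    refine hun ?_
    have h1 := Submodule.add_mem N hxN ⟨t, ht⟩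
    simpa using h1
  obtain ⟨θ, hθ, hθ0⟩ := exists_functional_eq_one _ _ hnot
  refine ⟨.middle ⟨r, by omega⟩, u, θ, huF, hbab _, hθ, fun x => by simp [haba],
    fun s hs x hx => ?_⟩
  have hs' : s < r := hs
  exact hθ0 _ ⟨x, D.F_mono (by omega) hx, rfl⟩

/-- Every nonzero flag pair has a summand of one of the finitely many kinds, possibly after
exchanging the two spaces. -/
lemma exists_hasKind (D : FlagPair V W) (h : (∃ x : V, x ≠ 0) ∨ ∃ y : W, y ≠ 0) :
    (∃ c, D.HasKind c) ∨ ∃ c, D.swap.HasKind c := by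
  by_contra! hno
  obtain ⟨h1, h2⟩ := hno
  have n1 : ¬ ∃ c, D.HasKind c := by push Not; exact h1
  have n2 : ¬ ∃ c, D.swap.HasKind c := by push Not; exact h2
  have haba : ∀ x, D.a (D.b (D.a x)) = 0 := fun x => by
    by_contra hx; exact h1 _ (D.hasKind_proj x hx)
  have hbab : ∀ y, D.b (D.a (D.b y)) = 0 := fun y => by
    by_contra hy; exact h2 _ (D.swap.hasKind_proj y hy)
  have hA : ∀ x, D.b (D.a x) = 0 → x ∈ LinearMap.ker D.a ⊔ LinearMap.range D.b := fun x hx => by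
    by_contra hn; exact n1 (D.hasKind_chain x hx hn)
  have hB : ∀ y, D.a (D.b y) = 0 → y ∈ LinearMap.ker D.b ⊔ LinearMap.range D.a := fun y hy => by
    by_contra hn; exact n2 (D.swap.hasKind_chain y hy hn)
  have hX : ∀ x, D.a x = 0 → x ∈ LinearMap.range (D.b.comp D.a) := fun x hx => by
    by_contra hn; exact n1 (D.hasKind_simple_or_diagonal haba hbab hB x hx hn)
  have hY : ∀ y, D.b y = 0 → y ∈ LinearMap.range (D.a.comp D.b) := fun y hy => by
    by_contra hn; exact n2 (D.swap.hasKind_simple_or_diagonal hbab haba hA y hy hn)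
  have hb : ∀ y, D.b y ∈ LinearMap.range (D.b.comp D.a) := fun y => by
    by_contra hn; exact n1 (D.hasKind_middle haba hbab hX y hn)
  have ha : ∀ x, D.a x ∈ LinearMap.range (D.a.comp D.b) := fun x => by
    by_contra hn; exact n2 (D.swap.hasKind_middle hbab haba hY x hn)
  have ha0 : ∀ x, D.a x = 0 := fun x => by
    obtain ⟨w, hw⟩ := ha x
    obtain ⟨u, hu⟩ := hb w
    rw [← hw, LinearMap.comp_apply, ← hu, LinearMap.comp_apply, haba]
  have hb0 : ∀ y, D.b y = 0 := fun y => by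
    obtain ⟨u, hu⟩ := hb y
    rw [← hu, LinearMap.comp_apply, ha0, map_zero]
  rcases h with ⟨x, hx⟩ | ⟨y, hy⟩
  · obtain ⟨u, hu⟩ := hX x (ha0 x)
    exact hx (by rw [← hu, LinearMap.comp_apply, hb0])
  · obtain ⟨u, hu⟩ := hY y (hb0 y)
    exact hy (by rw [← hu, LinearMap.comp_apply, ha0])

end FlagPair

/-! ### From `e(2)`-modules to flag pairs -/

namespace E2Mod

lemma mem_wt {M : E2Mod} {k : ℤ} {v : M.V} : v ∈ M.wt k ↔ M.L v = (k : ℂ) • v := by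
  simp [wt, sub_eq_zero]

lemma Pp_mem {M : E2Mod} {k : ℤ} {v : M.V} (hv : v ∈ M.wt k) : M.Pp v ∈ M.wt (k + 1) := by
  have h := LinearMap.congr_fun M.relp v
  rw [mem_wt] at hv ⊢
  simp only [LinearMap.sub_apply, LinearMap.comp_apply, hv, map_smul] at h
  rw [sub_eq_iff_eq_add.mp h]
  push_cast
  module

lemma Pm_mem {M : E2Mod} {k : ℤ} {v : M.V} (hv : v ∈ M.wt k) : M.Pm v ∈ M.wt (k - 1) := by
  have h := LinearMap.congr_fun M.relm v
  rw [mem_wt] at hv ⊢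
  simp only [LinearMap.sub_apply, LinearMap.comp_apply, hv, map_smul, LinearMap.neg_apply] at h
  rw [sub_eq_iff_eq_add.mp h]
  push_cast
  module

lemma Pp_Pm (M : E2Mod) (v : M.V) : M.Pp (M.Pm v) = M.Pm (M.Pp v) :=
  LinearMap.congr_fun M.comm v

lemma isInternal (M : E2Mod) : DirectSum.IsInternal M.wt := M.internal

/-- The restriction of `P₊` to weight spaces. -/
def up (M : E2Mod) (k l : ℤ) (h : l = k + 1) : M.wt k →ₗ[ℂ] M.wt l :=
  M.Pp.restrict fun _ hv => h ▸ Pp_mem hv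

/-- The restriction of `P₋` to weight spaces. -/
def down (M : E2Mod) (k l : ℤ) (h : l = k - 1) : M.wt k →ₗ[ℂ] M.wt l :=
  M.Pm.restrict fun _ hv => h ▸ Pm_mem hv

@[simp] lemma coe_up (M : E2Mod) (k l : ℤ) (h : l = k + 1) (v : M.wt k) :
    (M.up k l h v : M.V) = M.Pp v := rfl

@[simp] lemma coe_down (M : E2Mod) (k l : ℤ) (h : l = k - 1) (v : M.wt k) :
    (M.down k l h v : M.V) = M.Pm v := rfl

/-- The weights of `M` lie in the interval `[m, m + 3]`. -/
def SupportedFrom (M : E2Mod) (m : ℤ) : Prop :=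
  ∀ k, k < m ∨ m + 3 < k → M.wt k = ⊥

lemma SupportedFrom.Pm_eq {M : E2Mod} {m : ℤ} (hM : M.SupportedFrom m) {v : M.V}
    (hv : v ∈ M.wt m) : M.Pm v = 0 := by
  have h := Pm_mem hv
  rwa [hM _ (by omega), Submodule.mem_bot] at h

lemma SupportedFrom.Pp_eq {M : E2Mod} {m : ℤ} (hM : M.SupportedFrom m) {v : M.V}
    (hv : v ∈ M.wt (m + 3)) : M.Pp v = 0 := by
  have h := Pp_mem hv
  rwa [hM _ (by omega), Submodule.mem_bot] at h

/-- The flag `0 ≤ S ≤ T ≤ V`. -/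
def flag {V : Type} [AddCommGroup V] [Module ℂ V] (S T : Submodule ℂ V) : ℕ → Submodule ℂ V
  | 0 => ⊥
  | 1 => S
  | 2 => T
  | _ => ⊤

lemma flag_mono {V : Type} [AddCommGroup V] [Module ℂ V] {S T : Submodule ℂ V} (h : S ≤ T) :
    Monotone (flag S T) :=
  monotone_nat_of_le_succ fun
    | 0 => bot_le
    | 1 => h
    | 2 => le_top
    | _ + 3 => le_top

/-- The flag pair on the two middle weight spaces of a module supported on four consecutive
weights. -/
def flagPair (M : E2Mod) (m : ℤ) (hM : M.SupportedFrom m) :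
    FlagPair (M.wt (m + 1)) (M.wt (m + 2)) where
  a := M.up _ _ (by ring)
  b := M.down _ _ (by ring)
  F := flag (LinearMap.range (M.up m (m + 1) rfl))
    (LinearMap.ker (M.down (m + 1) m (by ring)))
  G := flag (LinearMap.range (M.down (m + 3) (m + 2) (by ring)))
    (LinearMap.ker (M.up (m + 2) (m + 3) (by ring)))
  F_mono := flag_mono <| by
    rintro _ ⟨x, rfl⟩
    ext
    simp [← Pp_Pm, hM.Pm_eq x.2]
  G_mono := flag_mono <| by
    rintro _ ⟨x, rfl⟩
    ext
    simp [Pp_Pm, hM.Pp_eq x.2]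
  F_zero := rfl
  G_zero := rfl
  F_three := rfl
  G_three := rfl
  ba_mem x := ⟨M.down _ _ (by ring) x, by ext; simp [Pp_Pm]⟩
  ab_mem x := ⟨M.up _ _ (by ring) x, by ext; simp [Pp_Pm]⟩
  ba_eq x hx := by
    have h : M.Pm x = 0 := congrArg Subtype.val (LinearMap.mem_ker.mp hx)
    ext
    simp [← Pp_Pm, h]
  ab_eq x hx := by
    have h : M.Pp x = 0 := congrArg Subtype.val (LinearMap.mem_ker.mp hx)
    ext
    simp [Pp_Pm, h]

/-- Morphisms of `e(2)`-modules. -/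
structure IsHom (M N : E2Mod) (f : M.V →ₗ[ℂ] N.V) : Prop where
  map_Pp : ∀ v, f (M.Pp v) = N.Pp (f v)
  map_Pm : ∀ v, f (M.Pm v) = N.Pm (f v)
  map_L : ∀ v, f (M.L v) = N.L (f v)

lemma IsHom.comp {M N K : E2Mod} {f : M.V →ₗ[ℂ] N.V} {g : N.V →ₗ[ℂ] K.V} (hg : N.IsHom K g)
    (hf : M.IsHom N f) : M.IsHom K (g.comp f) :=
  ⟨fun v => by simp [hf.map_Pp, hg.map_Pp], fun v => by simp [hf.map_Pm, hg.map_Pm],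
    fun v => by simp [hf.map_L, hg.map_L]⟩

lemma IsHom.pow {M : E2Mod} {h : M.V →ₗ[ℂ] M.V} (hh : M.IsHom M h) (n : ℕ) :
    M.IsHom M (h ^ n) := by
  induction n with
  | zero => exact ⟨fun _ => rfl, fun _ => rfl, fun _ => rfl⟩
  | succ n ih => exact pow_succ h n ▸ ih.comp hh

lemma IsHom.isSubmod_ker {M N : E2Mod} {f : M.V →ₗ[ℂ] N.V} (hf : M.IsHom N f) :
    M.IsSubmod (LinearMap.ker f) :=
  ⟨fun v hv => by simp_all [hf.map_Pp], fun v hv => by simp_all [hf.map_Pm],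
    fun v hv => by simp_all [hf.map_L]⟩

lemma IsHom.isSubmod_range {M N : E2Mod} {f : M.V →ₗ[ℂ] N.V} (hf : M.IsHom N f) :
    N.IsSubmod (LinearMap.range f) := by
  refine ⟨?_, ?_, ?_⟩ <;> rintro _ ⟨v, rfl⟩
  · exact ⟨_, hf.map_Pp v⟩
  · exact ⟨_, hf.map_Pm v⟩
  · exact ⟨_, hf.map_L v⟩

/-- An endomorphism of an indecomposable module that fixes a nonzero vector is injective. -/
lemma Indecomposable.injective {M : E2Mod} (hM : M.Indecomposable) {h : M.V →ₗ[ℂ] M.V}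
    (hh : M.IsHom M h) {x : M.V} (hx : x ≠ 0) (hfix : h x = x) : Function.Injective h := by
  obtain ⟨n, hc, hn⟩ :=
    ((LinearMap.eventually_isCompl_ker_pow_range_pow h).and (Filter.eventually_ge_atTop 1)).exists
  have hpow : ∀ j : ℕ, (h ^ j) x = x := fun j => by
    induction j with
    | zero => rfl
    | succ j ih => rw [pow_succ, Module.End.mul_apply, hfix, ih]
  rcases hM.2 _ _ (hh.pow n).isSubmod_ker (hh.pow n).isSubmod_range hc.inf_eq_bot
    hc.sup_eq_top with h0 | h0
  · rw [injective_iff_map_eq_zero]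
    intro y hy
    have hmem : y ∈ LinearMap.ker (h ^ n) := by
      obtain ⟨j, rfl⟩ := Nat.exists_eq_add_of_le' hn
      simp [pow_succ, hy]
    simpa [h0] using hmem
  · have hmem : x ∈ LinearMap.range (h ^ n) := ⟨x, hpow n⟩
    rw [h0, Submodule.mem_bot] at hmem
    exact absurd hmem hx

lemma iso_of_isHom {M N : E2Mod} (hM : M.Indecomposable) (hN : N.Indecomposable)
    {f : M.V →ₗ[ℂ] N.V} {g : N.V →ₗ[ℂ] M.V} (hf : M.IsHom N f) (hg : N.IsHom M g) {x : M.V}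
    (hx : x ≠ 0) (hfix : g (f x) = x) : M.Iso N := by
  have hfi : Function.Injective f :=
    Function.Injective.of_comp (f := g) (hM.injective (hg.comp hf) hx hfix)
  have hfx : f x ≠ 0 := fun h0 => hx (by rw [← hfix, h0, map_zero])
  have hfg : Function.Injective (f.comp g) :=
    hN.injective (hf.comp hg) hfx (by simp [hfix])
  have hfs : Function.Surjective f :=
    Function.Surjective.of_comp (g := g) (LinearMap.injective_iff_surjective.mp hfg)
  exact ⟨LinearEquiv.ofBijective f ⟨hfi, hfs⟩, hf.map_Pp, hf.map_Pm, hf.map_L⟩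

lemma exists_component (M : E2Mod) (k : ℤ) :
    ∃ c : M.V →ₗ[ℂ] M.wt k, (∀ x : M.wt k, c x = x) ∧ ∀ l ≠ k, ∀ x ∈ M.wt l, c x = 0 := by
  let e := LinearEquiv.ofBijective (DirectSum.coeLinearMap M.wt) M.isInternal
  have he : ∀ l (x : M.wt l), e.symm x = DirectSum.lof ℂ ℤ (fun k => M.wt k) l x :=
    fun l x => by
      rw [LinearEquiv.symm_apply_eq]
      exact (DirectSum.coeLinearMap_lof M.wt l x).symm
  refine ⟨(DirectSum.component ℂ ℤ (fun k => M.wt k) k).comp e.symm.toLinearMap,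
    fun x => ?_, fun l hl x hx => ?_⟩
  · simp [he, DirectSum.component.lof_self]
  · have h1 := he l ⟨x, hx⟩
    simp only at h1
    simp [h1, DirectSum.component.of, hl]

lemma linearMap_ext {M : E2Mod} {m : ℤ} (hM : M.SupportedFrom m) {X : Type} [AddCommGroup X]
    [Module ℂ X] {f g : M.V →ₗ[ℂ] X} (h0 : ∀ x : M.wt m, f x = g x)
    (h1 : ∀ x : M.wt (m + 1), f x = g x) (h2 : ∀ x : M.wt (m + 2), f x = g x)
    (h3 : ∀ x : M.wt (m + 3), f x = g x) (v : M.V) : f v = g v := by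
  have htop : v ∈ ⨆ k, M.wt k := by
    rw [M.isInternal.submodule_iSup_eq_top]; trivial
  induction htop using Submodule.iSup_induction' with
  | mem k x hx =>
    by_cases hk : k < m ∨ m + 3 < k
    · rw [hM k hk, Submodule.mem_bot] at hx
      simp [hx]
    · obtain rfl | rfl | rfl | rfl : k = m ∨ k = m + 1 ∨ k = m + 2 ∨ k = m + 3 := by omega
      exacts [h0 ⟨x, hx⟩, h1 ⟨x, hx⟩, h2 ⟨x, hx⟩, h3 ⟨x, hx⟩]
  | zero => simp
  | add x y _ _ hx hy => rw [map_add, map_add, hx, hy]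

lemma exists_isHom {M N : E2Mod} {m : ℤ} (hM : M.SupportedFrom m) (hN : N.SupportedFrom m)
    (f₀ : M.wt m →ₗ[ℂ] N.wt m) (f₁ : M.wt (m + 1) →ₗ[ℂ] N.wt (m + 1))
    (f₂ : M.wt (m + 2) →ₗ[ℂ] N.wt (m + 2)) (f₃ : M.wt (m + 3) →ₗ[ℂ] N.wt (m + 3))
    (u₀ : ∀ x, f₁ (M.up m (m + 1) rfl x) = N.up m (m + 1) rfl (f₀ x))
    (u₁ : ∀ x, f₂ (M.up (m + 1) (m + 2) (by ring) x) = N.up (m + 1) (m + 2) (by ring) (f₁ x))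
    (u₂ : ∀ x, f₃ (M.up (m + 2) (m + 3) (by ring) x) = N.up (m + 2) (m + 3) (by ring) (f₂ x))
    (d₁ : ∀ x, f₀ (M.down (m + 1) m (by ring) x) = N.down (m + 1) m (by ring) (f₁ x))
    (d₂ : ∀ x, f₁ (M.down (m + 2) (m + 1) (by ring) x) =
      N.down (m + 2) (m + 1) (by ring) (f₂ x))
    (d₃ : ∀ x, f₂ (M.down (m + 3) (m + 2) (by ring) x) =
      N.down (m + 3) (m + 2) (by ring) (f₃ x)) :
    ∃ f, M.IsHom N f ∧ (∀ x : M.wt m, f x = f₀ x) ∧ (∀ x : M.wt (m + 1), f x = f₁ x) ∧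
      (∀ x : M.wt (m + 2), f x = f₂ x) ∧ ∀ x : M.wt (m + 3), f x = f₃ x := by
  obtain ⟨c₀, e₀, z₀⟩ := M.exists_component m
  obtain ⟨c₁, e₁, z₁⟩ := M.exists_component (m + 1)
  obtain ⟨c₂, e₂, z₂⟩ := M.exists_component (m + 2)
  obtain ⟨c₃, e₃, z₃⟩ := M.exists_component (m + 3)
  obtain ⟨f, hf⟩ : ∃ f : M.V →ₗ[ℂ] N.V, ∀ v, f v = f₀ (c₀ v) + f₁ (c₁ v) + f₂ (c₂ v) +
      f₃ (c₃ v) :=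
    ⟨(N.wt m).subtype.comp (f₀.comp c₀) + (N.wt (m + 1)).subtype.comp (f₁.comp c₁) +
      (N.wt (m + 2)).subtype.comp (f₂.comp c₂) + (N.wt (m + 3)).subtype.comp (f₃.comp c₃),
      fun v => by simp⟩
  have h₀ : ∀ x : M.wt m, f x = f₀ x := fun x => by
    rw [hf, e₀, z₁ m (by omega) x x.2, z₂ m (by omega) x x.2, z₃ m (by omega) x x.2]; simp
  have h₁ : ∀ x : M.wt (m + 1), f x = f₁ x := fun x => by
    rw [hf, e₁, z₀ _ (by omega) x x.2, z₂ _ (by omega) x x.2, z₃ _ (by omega) x x.2]; simp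
  have h₂ : ∀ x : M.wt (m + 2), f x = f₂ x := fun x => by
    rw [hf, e₂, z₀ _ (by omega) x x.2, z₁ _ (by omega) x x.2, z₃ _ (by omega) x x.2]; simp
  have h₃ : ∀ x : M.wt (m + 3), f x = f₃ x := fun x => by
    rw [hf, e₃, z₀ _ (by omega) x x.2, z₁ _ (by omega) x x.2, z₂ _ (by omega) x x.2]; simp
  refine ⟨f, ⟨?_, ?_, ?_⟩, h₀, h₁, h₂, h₃⟩
  · refine linearMap_ext hM (f := f.comp M.Pp) (g := N.Pp.comp f) ?_ ?_ ?_ ?_ <;> intro x <;>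
      simp only [LinearMap.comp_apply, h₀, h₁, h₂, h₃]
    · rw [← coe_up M m (m + 1) rfl, h₁, u₀, coe_up]
    · rw [← coe_up M (m + 1) (m + 2) (by ring), h₂, u₁, coe_up]
    · rw [← coe_up M (m + 2) (m + 3) (by ring), h₃, u₂, coe_up]
    · rw [hM.Pp_eq x.2, hN.Pp_eq (f₃ x).2, map_zero]
  · refine linearMap_ext hM (f := f.comp M.Pm) (g := N.Pm.comp f) ?_ ?_ ?_ ?_ <;> intro x <;>
      simp only [LinearMap.comp_apply, h₀, h₁, h₂, h₃]
    · rw [hM.Pm_eq x.2, hN.Pm_eq (f₀ x).2, map_zero]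
    · rw [← coe_down M (m + 1) m (by ring), h₀, d₁, coe_down]
    · rw [← coe_down M (m + 2) (m + 1) (by ring), h₁, d₂, coe_down]
    · rw [← coe_down M (m + 3) (m + 2) (by ring), h₂, d₃, coe_down]
  · refine linearMap_ext hM (f := f.comp M.L) (g := N.L.comp f) ?_ ?_ ?_ ?_ <;> intro x <;>
      simp only [LinearMap.comp_apply, h₀, h₁, h₂, h₃, mem_wt.mp x.2, map_smul]
    · exact (mem_wt.mp (f₀ x).2).symm
    · exact (mem_wt.mp (f₁ x).2).symm
    · exact (mem_wt.mp (f₂ x).2).symm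
    · exact (mem_wt.mp (f₃ x).2).symm

/-- A morphism of flag pairs extends to a morphism of modules. -/
lemma exists_isHom_of_flagPair {M N : E2Mod} {m : ℤ} (hM : M.SupportedFrom m)
    (hN : N.SupportedFrom m) {f₁ : M.wt (m + 1) →ₗ[ℂ] N.wt (m + 1)}
    {f₂ : M.wt (m + 2) →ₗ[ℂ] N.wt (m + 2)}
    (h : (M.flagPair m hM).IsHom (N.flagPair m hN) f₁ f₂) :
    ∃ f, M.IsHom N f ∧ (∀ x : M.wt (m + 1), f x = f₁ x) ∧
      (∀ x : M.wt (m + 2), f x = f₂ x) := by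
  have ha := h.map_a
  have hb := h.map_b
  have hPm : ∀ x : M.wt (m + 1), M.up m (m + 1) rfl (M.down (m + 1) m (by ring) x) =
      M.down (m + 2) (m + 1) (by ring) (M.up (m + 1) (m + 2) (by ring) x) := fun x => by
    ext; simp [Pp_Pm]
  have hPm' : ∀ x : N.wt (m + 1), N.up m (m + 1) rfl (N.down (m + 1) m (by ring) x) =
      N.down (m + 2) (m + 1) (by ring) (N.up (m + 1) (m + 2) (by ring) x) := fun x => by
    ext; simp [Pp_Pm]
  have hPp : ∀ x : M.wt (m + 2),
      M.down (m + 3) (m + 2) (by ring) (M.up (m + 2) (m + 3) (by ring) x) =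
      M.up (m + 1) (m + 2) (by ring) (M.down (m + 2) (m + 1) (by ring) x) := fun x => by
    ext; simp [Pp_Pm]
  have hPp' : ∀ x : N.wt (m + 2),
      N.down (m + 3) (m + 2) (by ring) (N.up (m + 2) (m + 3) (by ring) x) =
      N.up (m + 1) (m + 2) (by ring) (N.down (m + 2) (m + 1) (by ring) x) := fun x => by
    ext; simp [Pp_Pm]
  obtain ⟨f₀, h₀, h₀'⟩ := exists_extension_of_factorization
    (M.down (m + 1) m (by ring)) (M.up m (m + 1) rfl) (N.down (m + 1) m (by ring))
    (N.up m (m + 1) rfl) f₁ (fun x => by rw [hPm, hPm']; exact (hb _).trans (congrArg _ (ha x)))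
    (fun x hx => h.map_F 2 x hx) (fun y => h.map_F 1 _ ⟨y, rfl⟩)
  obtain ⟨f₃, h₃, h₃'⟩ := exists_extension_of_factorization
    (M.up (m + 2) (m + 3) (by ring)) (M.down (m + 3) (m + 2) (by ring))
    (N.up (m + 2) (m + 3) (by ring)) (N.down (m + 3) (m + 2) (by ring))
    f₂ (fun x => by rw [hPp, hPp']; exact (ha _).trans (congrArg _ (hb x)))
    (fun x hx => h.map_G 2 x hx) (fun y => h.map_G 1 _ ⟨y, rfl⟩)
  obtain ⟨f, hf, -, e₁, e₂, -⟩ := exists_isHom hM hN f₀ f₁ f₂ f₃ (fun x => (h₀' x).symm) ha h₃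
    h₀ hb (fun x => (h₃' x).symm)
  exact ⟨f, hf, e₁, e₂⟩

lemma iso_of_linked {M N : E2Mod} (hMi : M.Indecomposable) (hNi : N.Indecomposable) {m : ℤ}
    (hM : M.SupportedFrom m) (hN : N.SupportedFrom m)
    (h : (M.flagPair m hM).Linked (N.flagPair m hN)) : M.Iso N := by
  obtain ⟨f₁, f₂, g₁, g₂, h, h', hfix⟩ := h
  obtain ⟨f, hf, e₁, e₂⟩ := exists_isHom_of_flagPair hM hN h
  obtain ⟨g, hg, e₁', e₂'⟩ := exists_isHom_of_flagPair hN hM h'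
  rcases hfix with ⟨x, hx, hx'⟩ | ⟨x, hx, hx'⟩
  · exact iso_of_isHom hMi hNi hf hg (x := x) (by simpa using hx) (by rw [e₁, e₁', hx'])
  · exact iso_of_isHom hMi hNi hf hg (x := x) (by simpa using hx) (by rw [e₂, e₂', hx'])

lemma exists_linearMap_apply_eq {X Y : Type} [AddCommGroup X] [Module ℂ X] [AddCommGroup Y]
    [Module ℂ Y] {x : X} (hx : x ≠ 0) (y : Y) : ∃ f : X →ₗ[ℂ] Y, f x = y := by
  obtain ⟨t, ht, -⟩ := exists_functional_eq_one (⊥ : Submodule ℂ X) x (by simpa using hx)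
  exact ⟨t.smulRight y, by simp [ht]⟩

/-- Indecomposables whose middle weight spaces vanish are determined by their weight. -/
lemma iso_of_middle_eq_bot {M N : E2Mod} (hMi : M.Indecomposable) (hNi : N.Indecomposable)
    {m : ℤ} (hM : M.SupportedFrom m) (hN : N.SupportedFrom m)
    (hM₁ : M.wt (m + 1) = ⊥) (hM₂ : M.wt (m + 2) = ⊥) (hN₁ : N.wt (m + 1) = ⊥)
    (hN₂ : N.wt (m + 2) = ⊥)
    (h : (M.wt m ≠ ⊥ ∧ N.wt m ≠ ⊥) ∨ (M.wt (m + 3) ≠ ⊥ ∧ N.wt (m + 3) ≠ ⊥)) : M.Iso N := by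
  have s₁ := Submodule.subsingleton_iff_eq_bot.mpr hM₁
  have s₂ := Submodule.subsingleton_iff_eq_bot.mpr hM₂
  have t₁ := Submodule.subsingleton_iff_eq_bot.mpr hN₁
  have t₂ := Submodule.subsingleton_iff_eq_bot.mpr hN₂
  have glue : ∀ {M N : E2Mod} (_ : M.SupportedFrom m) (_ : N.SupportedFrom m)
      (_ : Subsingleton (M.wt (m + 1))) (_ : Subsingleton (M.wt (m + 2)))
      (_ : Subsingleton (N.wt (m + 1))) (_ : Subsingleton (N.wt (m + 2)))
      (f₀ : M.wt m →ₗ[ℂ] N.wt m) (f₃ : M.wt (m + 3) →ₗ[ℂ] N.wt (m + 3)),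
      ∃ f, M.IsHom N f ∧ (∀ x : M.wt m, f x = f₀ x) ∧ ∀ x : M.wt (m + 3), f x = f₃ x := by
    intro M N hM hN _ _ _ _ f₀ f₃
    obtain ⟨f, hf, e₀, -, -, e₃⟩ := exists_isHom hM hN f₀ 0 0 f₃
      (fun x => Subsingleton.elim _ _) (fun x => Subsingleton.elim _ _)
      (fun x => by simp [Subsingleton.elim x 0]) (fun x => by simp [Subsingleton.elim x 0])
      (fun x => Subsingleton.elim _ _) (fun x => Subsingleton.elim _ _)
    exact ⟨f, hf, e₀, e₃⟩
  rcases h with ⟨h, h'⟩ | ⟨h, h'⟩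
  all_goals
    obtain ⟨x, hx, hx0⟩ := Submodule.exists_mem_ne_zero_of_ne_bot h
    obtain ⟨y, hy, hy0⟩ := Submodule.exists_mem_ne_zero_of_ne_bot h'
    obtain ⟨f₀, hf₀⟩ := exists_linearMap_apply_eq (x := (⟨x, hx⟩ : M.wt _)) (by simpa using hx0)
      (⟨y, hy⟩ : N.wt _)
    obtain ⟨g₀, hg₀⟩ := exists_linearMap_apply_eq (x := (⟨y, hy⟩ : N.wt _)) (by simpa using hy0)
      (⟨x, hx⟩ : M.wt _)
  · obtain ⟨f, hf, ef, -⟩ := glue hM hN s₁ s₂ t₁ t₂ f₀ 0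
    obtain ⟨g, hg, eg, -⟩ := glue hN hM t₁ t₂ s₁ s₂ g₀ 0
    have ef' := ef ⟨x, hx⟩
    have eg' := eg ⟨y, hy⟩
    simp only [hf₀, hg₀] at ef' eg'
    exact iso_of_isHom hMi hNi hf hg hx0 (by rw [ef', eg'])
  · obtain ⟨f, hf, -, ef⟩ := glue hM hN s₁ s₂ t₁ t₂ 0 f₀
    obtain ⟨g, hg, -, eg⟩ := glue hN hM t₁ t₂ s₁ s₂ 0 g₀
    have ef' := ef ⟨x, hx⟩
    have eg' := eg ⟨y, hy⟩
    simp only [hf₀, hg₀] at ef' eg'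
    exact iso_of_isHom hMi hNi hf hg hx0 (by rw [ef', eg'])

lemma Indecomposable.exists_wt_ne_bot {M : E2Mod} (hM : M.Indecomposable) :
    ∃ k, M.wt k ≠ ⊥ := by
  by_contra! h
  obtain ⟨v, hv⟩ := hM.1
  have h1 : v ∈ ⨆ k, M.wt k := by rw [M.isInternal.submodule_iSup_eq_top]; trivial
  simp [h] at h1
  exact hv h1

lemma isSubmod_biSup (M : E2Mod) (S : Set ℤ)
    (hp : ∀ k ∈ S, k + 1 ∈ S ∨ M.wt (k + 1) = ⊥) (hm : ∀ k ∈ S, k - 1 ∈ S ∨ M.wt k = ⊥) :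
    M.IsSubmod (⨆ k ∈ S, M.wt k) := by
  have key : ∀ (P : M.V →ₗ[ℂ] M.V),
      (∀ k ∈ S, ∀ v ∈ M.wt k, P v ∈ ⨆ k ∈ S, M.wt k) →
      ∀ v ∈ ⨆ k ∈ S, M.wt k, P v ∈ ⨆ k ∈ S, M.wt k := fun P hP => by
    have : (⨆ k ∈ S, M.wt k) ≤ (⨆ k ∈ S, M.wt k).comap P := iSup₂_le hP
    exact this
  refine ⟨key _ fun k hk v hv => ?_, key _ fun k hk v hv => ?_, key _ fun k hk v hv => ?_⟩
  · rcases hp k hk with h | h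
    · exact Submodule.mem_iSup_of_mem _ (Submodule.mem_iSup_of_mem h (Pp_mem hv))
    · have h1 := Pp_mem hv
      rw [h, Submodule.mem_bot] at h1
      simp [h1]
  · rcases hm k hk with h | h
    · exact Submodule.mem_iSup_of_mem _ (Submodule.mem_iSup_of_mem h (Pm_mem hv))
    · rw [h, Submodule.mem_bot] at hv
      simp [hv]
  · rw [mem_wt.mp hv]
    exact Submodule.smul_mem _ _
      (Submodule.mem_iSup_of_mem _ (Submodule.mem_iSup_of_mem hk hv))

/-- The weights of an indecomposable module form an interval. -/
lemma Indecomposable.wt_eq_bot_of_lt {M : E2Mod} (hM : M.Indecomposable) {j i k : ℤ} (hji : j < i)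
    (hik : i ≤ k) (hj : M.wt j ≠ ⊥) (hi : M.wt i = ⊥) : M.wt k = ⊥ := by
  have hdisj : Disjoint (⨆ k ∈ Set.Iio i, M.wt k) (⨆ k ∈ Set.Ici i, M.wt k) :=
    M.isInternal.submodule_iSupIndep.disjoint_biSup_biSup
      (Set.disjoint_left.mpr fun x hx hx' => not_lt.mpr (Set.mem_Ici.mp hx') hx)
  have hsup : (⨆ k ∈ Set.Iio i, M.wt k) ⊔ (⨆ k ∈ Set.Ici i, M.wt k) = ⊤ := by
    rw [← iSup_union, Set.Iio_union_Ici, ← M.isInternal.submodule_iSup_eq_top]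
    simp
  have h₁ : M.IsSubmod (⨆ k ∈ Set.Iio i, M.wt k) := by
    refine M.isSubmod_biSup _ (fun k hk => ?_) fun k hk => ?_
    · rcases lt_or_eq_of_le (Int.add_one_le_iff.mpr (Set.mem_Iio.mp hk)) with h | h
      · exact Or.inl h
      · exact Or.inr (h ▸ hi)
    · rw [Set.mem_Iio] at hk ⊢
      omega
  have h₂ : M.IsSubmod (⨆ k ∈ Set.Ici i, M.wt k) := by
    refine M.isSubmod_biSup _ (fun k hk => ?_) fun k hk => ?_
    · rw [Set.mem_Ici] at hk ⊢
      omega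
    · rcases lt_or_eq_of_le (Set.mem_Ici.mp hk) with h | h
      · exact Or.inl (Int.le_sub_one_iff.mpr h)
      · exact Or.inr (h ▸ hi)
  rcases hM.2 _ _ h₁ h₂ hdisj.eq_bot hsup with h | h
  · exact absurd (le_bot_iff.mp (h ▸ le_biSup M.wt (Set.mem_Iio.mpr hji))) hj
  · exact le_bot_iff.mp (h ▸ le_biSup M.wt (Set.mem_Ici.mpr hik))

lemma Indecomposable.exists_supportedFrom {M : E2Mod} (hM : M.Indecomposable) {A : Finset ℤ}
    (hA : ∀ m : ℤ, ∃ i : ℤ, m ≤ i ∧ i ≤ m + 4 ∧ i ∉ A) (hMA : ∀ k ∉ A, M.wt k = ⊥) :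
    ∃ m ∈ A, M.SupportedFrom m := by
  classical
  have hmem : ∀ k, M.wt k ≠ ⊥ → k ∈ A := fun k hk => by
    by_contra h
    exact hk (hMA k h)
  obtain ⟨k, hk⟩ := hM.exists_wt_ne_bot
  obtain ⟨m, hm, hmin⟩ := (A.filter fun k => M.wt k ≠ ⊥).exists_minimal
    ⟨k, Finset.mem_filter.mpr ⟨hmem k hk, hk⟩⟩
  rw [Finset.mem_filter] at hm
  obtain ⟨i, hmi, him, hiA⟩ := hA m
  have hi := hMA i hiA
  refine ⟨m, hm.1, fun l hl => ?_⟩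
  rcases hl with hl | hl
  · by_contra h
    exact absurd (hmin (Finset.mem_filter.mpr ⟨hmem l h, h⟩) hl.le) (not_le.mpr hl)
  · refine hM.wt_eq_bot_of_lt (lt_of_le_of_ne hmi ?_) (by omega) hm.2 hi
    rintro rfl
    exact hm.2 hi

/-- The discrete invariants of an indecomposable module supported on four consecutive weights. -/
def HasInvariant (M : E2Mod) (m : ℤ) : (FlagPair.Kind × Bool) ⊕ Bool → Prop
  | .inl (c, false) => ∃ hM : M.SupportedFrom m, (M.flagPair m hM).HasKind c
  | .inl (c, true) => ∃ hM : M.SupportedFrom m, (M.flagPair m hM).swap.HasKind c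
  | .inr false => M.SupportedFrom m ∧ M.wt (m + 1) = ⊥ ∧ M.wt (m + 2) = ⊥ ∧ M.wt m ≠ ⊥
  | .inr true => M.SupportedFrom m ∧ M.wt (m + 1) = ⊥ ∧ M.wt (m + 2) = ⊥ ∧ M.wt (m + 3) ≠ ⊥

lemma HasInvariant.iso {M N : E2Mod} (hM : M.Indecomposable) (hN : N.Indecomposable) {m : ℤ} :
    ∀ {c}, M.HasInvariant m c → N.HasInvariant m c → M.Iso N
  | .inl (_, false), ⟨_, h⟩, ⟨_, h'⟩ => iso_of_linked hM hN _ _ (h.linked h')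
  | .inl (_, true), ⟨_, h⟩, ⟨_, h'⟩ =>
    iso_of_linked hM hN _ _ (FlagPair.Linked.of_swap (h.linked h'))
  | .inr false, ⟨s, h₁, h₂, h⟩, ⟨s', h₁', h₂', h'⟩ =>
    iso_of_middle_eq_bot hM hN s s' h₁ h₂ h₁' h₂' (Or.inl ⟨h, h'⟩)
  | .inr true, ⟨s, h₁, h₂, h⟩, ⟨s', h₁', h₂', h'⟩ =>
    iso_of_middle_eq_bot hM hN s s' h₁ h₂ h₁' h₂' (Or.inr ⟨h, h'⟩)

lemma Indecomposable.exists_hasInvariant {M : E2Mod} (hM : M.Indecomposable) {m : ℤ}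
    (hs : M.SupportedFrom m) : ∃ c, M.HasInvariant m c := by
  by_cases h : (∃ x : M.wt (m + 1), x ≠ 0) ∨ ∃ y : M.wt (m + 2), y ≠ 0
  · rcases (M.flagPair m hs).exists_hasKind h with ⟨c, hc⟩ | ⟨c, hc⟩
    · exact ⟨.inl (c, false), hs, hc⟩
    · exact ⟨.inl (c, true), hs, hc⟩
  · simp only [not_or, not_exists, not_not] at h
    have h₁ : M.wt (m + 1) = ⊥ := (Submodule.eq_bot_iff _).mpr fun x hx =>
      congrArg Subtype.val (h.1 ⟨x, hx⟩)
    have h₂ : M.wt (m + 2) = ⊥ := (Submodule.eq_bot_iff _).mpr fun x hx =>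
      congrArg Subtype.val (h.2 ⟨x, hx⟩)
    obtain ⟨k, hk⟩ := hM.exists_wt_ne_bot
    obtain rfl | rfl : k = m ∨ k = m + 3 := by
      by_contra hne
      refine hk ?_
      by_cases hk' : k < m ∨ m + 3 < k
      · exact hs k hk'
      · obtain rfl | rfl : k = m + 1 ∨ k = m + 2 := by omega
        exacts [h₁, h₂]
    · exact ⟨.inr false, hs, h₁, h₂, hk⟩
    · exact ⟨.inr true, hs, h₁, h₂, hk⟩

/-- Finitely many properties, each determining a module up to isomorphism, are realized by
finitely many modules up to isomorphism. -/
lemma exists_finite_representatives {ι : Type} [Finite ι] (P : ι → E2Mod → Prop)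
    (hP : ∀ i M N, P i M → P i N → M.Iso N) :
    ∃ (n : ℕ) (Vs : Fin n → E2Mod), ∀ i M, P i M → ∃ j, M.Iso (Vs j) := by
  obtain ⟨n, ⟨e⟩⟩ := Finite.exists_equiv_fin {i // ∃ M, P i M}
  refine ⟨n, fun j => (e.symm j).2.choose, fun i M hM => ⟨e ⟨i, M, hM⟩, hP i _ _ hM ?_⟩⟩
  have h : ∀ x : {i // ∃ M, P i M}, P x x.2.choose := fun x => x.2.choose_spec
  simpa using h (e.symm (e ⟨i, M, hM⟩))

end E2Mod

/-- If a finite subset `A ⊆ ℤ` contains no five consecutive integers, then there are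
finitely many isomorphism classes of indecomposable `e(2)`-modules all of whose weights
lie in `A`. -/
theorem stmt_1 (A : Finset ℤ)
    (hA : ∀ m : ℤ, ∃ i : ℤ, m ≤ i ∧ i ≤ m + 4 ∧ i ∉ A) :
    ∃ (n : ℕ) (Vs : Fin n → E2Mod),
      ∀ M : E2Mod, M.Indecomposable → (∀ k : ℤ, k ∉ A → M.wt k = ⊥) →
        ∃ j : Fin n, M.Iso (Vs j) := by
  obtain ⟨n, Vs, h⟩ := E2Mod.exists_finite_representatives
    (ι := A × ((FlagPair.Kind × Bool) ⊕ Bool))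
    (fun i M => M.Indecomposable ∧ M.HasInvariant i.1 i.2)
    fun _ _ _ hM hN => E2Mod.HasInvariant.iso hM.1 hN.1 hM.2 hN.2
  refine ⟨n, Vs, fun M hM hMA => ?_⟩
  obtain ⟨m, hm, hs⟩ := hM.exists_supportedFrom hA hMA
  obtain ⟨c, hc⟩ := hM.exists_hasInvariant hs
  exact h (⟨m, hm⟩, c) M ⟨hM, hc⟩
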